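/- arXiv:2512.08369 — 3 statements merged into one kernel-verified Lean document; each statement's English description precedes it below -/
import Mathlib

section
/- A finite sequence of nonnegative real numbers a_0, a_1, …, a_n is a Pólya frequency sequence (i.e., its infinite Toeplitz matrix [a_{i-j}]_{i,j≥0}, with a_k = 0 for k < 0 or k > n, is totally positive) if and only if the polynomial a_0 + a_1 x + ⋯ + a_n x^n is a constant or has only real roots. -/
/-- An infinite real matrix is totally positive if all its minors are nonnegative. -/
def TotallyPos (A : ℕ → ℕ → ℝ) : Prop :=
  ∀ (k : ℕ) (f g : Fin k → ℕ), StrictMono f → StrictMono g →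
    0 ≤ Matrix.det (Matrix.of fun i j : Fin k => A (f i) (g j))

/-- A real polynomial is real-rooted if it is constant or all of its complex
roots are real. -/
def RealRooted (p : Polynomial ℝ) : Prop :=
  p.natDegree = 0 ∨ ∀ z : ℂ, Polynomial.aeval z p = 0 → z.im = 0


theorem det_nonneg_of_sum {k : ℕ} {ι : Type*} [Fintype ι] (w : Fin k → ι → ℝ)
    (C : Fin k → ι → Fin k → ℝ) (hw : ∀ j e, 0 ≤ w j e)
    (h : ∀ φ : Fin k → ι, (∀ j, w j (φ j) ≠ 0) →
      0 ≤ Matrix.det (Matrix.of fun i j => C j (φ j) i)) :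
    0 ≤ Matrix.det (Matrix.of fun i j => ∑ e, w j e * C j e i) := by
  classical
  have h1 : Matrix.det (Matrix.of fun i j => ∑ e, w j e * C j e i)
      = (Matrix.detRowAlternating (n := Fin k) (R := ℝ)).toMultilinearMap
        (fun j => ∑ e, w j e • C j e) := by
    rw [← Matrix.det_transpose]
    show Matrix.det _ = Matrix.det _
    congr 1
    ext j i
    simp [Finset.sum_apply]
  rw [h1, MultilinearMap.map_sum]
  refine Finset.sum_nonneg fun φ _ => ?_
  have h2 := MultilinearMap.map_smul_univ
    (Matrix.detRowAlternating (n := Fin k) (R := ℝ)).toMultilinearMap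
    (fun j => w j (φ j)) (fun j => C j (φ j))
  rw [h2, smul_eq_mul]
  by_cases hφ : ∀ j, w j (φ j) ≠ 0
  · refine mul_nonneg (Finset.prod_nonneg fun j _ => hw _ _) ?_
    have := h φ hφ
    rw [← Matrix.det_transpose] at this
    exact this
  · push Not at hφ
    obtain ⟨j, hj⟩ := hφ
    rw [Finset.prod_eq_zero (Finset.mem_univ j) hj, zero_mul]

theorem varDim (c : ℕ) : ∀ (N : ℕ) (A : Fin (c + 1) → Fin N → ℝ)
    (_ : ∀ (k : ℕ) (f : Fin k → Fin (c + 1)) (g : Fin k → Fin N), StrictMono f → StrictMono g →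
      0 ≤ Matrix.det (Matrix.of fun i j : Fin k => A (f i) (g j)))
    (x : Fin N → ℝ) (b : Fin N → ℕ) (_ : Monotone b) (_ : ∀ l, x l ≠ 0 → b l < c)
    (t : ℝ) (_ : t * t = 1) (_ : ∀ l, 0 ≤ t * (-1) ^ (b l) * x l)
    (s : ℝ) (_ : ∀ i : Fin (c + 1), 0 < s * (-1) ^ (i : ℕ) * ∑ l, A i l * x l), False := by
  induction c with
  | zero =>
    intro N A _ x b _ hc t _ _ s hs
    have h0 : ∀ l, x l = 0 := fun l => by
      by_contra h
      exact absurd (hc l h) (Nat.not_lt_zero _)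
    have := hs 0
    simp [h0] at this
  | succ c ih =>
    intro N A hA x b hb hc t ht hx s hs
    let B : Fin (c + 2) → Fin (c + 1) → ℝ := fun i k =>
      ∑ l, (if b l = (k : ℕ) then |x l| else 0) * A i l
    have hB : ∀ (k : ℕ) (f : Fin k → Fin (c + 2)) (g : Fin k → Fin (c + 1)),
        StrictMono f → StrictMono g →
        0 ≤ Matrix.det (Matrix.of fun i j : Fin k => B (f i) (g j)) := by
      intro k f g hf hg
      refine det_nonneg_of_sum (fun j l => if b l = (g j : ℕ) then |x l| else 0)
        (fun _ l i => A (f i) l) (fun j l => by positivity) ?_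
      intro φ hφ
      refine hA k f φ hf ?_
      intro i j hij
      have hi : b (φ i) = g i := by
        by_contra h; exact hφ i (by simp [h])
      have hj : b (φ j) = g j := by
        by_contra h; exact hφ j (by simp [h])
      by_contra hle
      have h1 := hb (not_lt.mp hle)
      have h2 : (g i : ℕ) < g j := hg hij
      omega
    let u : Fin (c + 1) → ℝ := fun k => t * (-1) ^ (k : ℕ)
    have hsq : ∀ m : ℕ, ((-1 : ℝ) ^ m) * (-1) ^ m = 1 := fun m => by
      rw [← mul_pow]; simp
    have hu1 : ∀ k, u k * u k = 1 := fun k => by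
      show t * (-1) ^ (k : ℕ) * (t * (-1) ^ (k : ℕ)) = 1
      linear_combination ((-1 : ℝ) ^ (k : ℕ) * (-1) ^ (k : ℕ)) * ht + hsq k
    have habs : ∀ k, |u k| = 1 := fun k => by
      have := hu1 k
      rw [← abs_mul_abs_self] at this
      nlinarith [abs_nonneg (u k)]
    have hxl : ∀ l, |x l| * (t * (-1) ^ (b l)) = x l := by
      intro l
      have h1 : (t * (-1) ^ (b l)) * (t * (-1) ^ (b l)) = 1 := by
        linear_combination ((-1 : ℝ) ^ (b l) * (-1) ^ (b l)) * ht + hsq (b l)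
      have h2 : |t * (-1) ^ (b l)| = 1 := by
        rw [← abs_mul_abs_self] at h1
        nlinarith [abs_nonneg (t * (-1) ^ (b l))]
      have h3 : |x l| = t * (-1) ^ (b l) * x l := by
        rw [← abs_of_nonneg (hx l), abs_mul, h2, one_mul]
      rw [h3]
      linear_combination x l * h1
    have hBu : ∀ i, ∑ k, B i k * u k = ∑ l, A i l * x l := by
      intro i
      simp only [B, Finset.sum_mul]
      rw [Finset.sum_comm]
      refine Finset.sum_congr rfl fun l _ => ?_
      by_cases h0 : x l = 0
      · simp [h0]
      · have hl := hc l h0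
        rw [Finset.sum_eq_single (⟨b l, hl⟩ : Fin (c + 1))]
        · simp only [if_true, u]
          linear_combination A i l * hxl l
        · intro k _ hk
          rw [if_neg, zero_mul, zero_mul]
          intro h; exact hk (Fin.ext h.symm)
        · simp
    -- the bordered determinant
    let y : Fin (c + 2) → ℝ := fun i => ∑ l, A i l * x l
    let M : Matrix (Fin (c + 2)) (Fin (c + 2)) ℝ := Matrix.of fun i => Fin.cons (y i) (B i)
    have hM : M.det = 0 := by
      rw [← Matrix.exists_mulVec_eq_zero_iff]
      refine ⟨Fin.cons (-1) u, ?_, ?_⟩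
      · intro h
        have := congrFun h 0
        simp at this
      · ext i
        simp only [Matrix.mulVec, dotProduct, Fin.sum_univ_succ, M, Matrix.of_apply, Fin.cons_zero,
          Fin.cons_succ, Pi.zero_apply]
        have := hBu i
        simp only [y]
        rw [Fin.sum_univ_succ] at this
        linear_combination this
    rw [Matrix.det_succ_column_zero] at hM
    have hmin : ∀ i : Fin (c + 2), 0 ≤ (M.submatrix i.succAbove Fin.succ).det := by
      intro i
      exact hB (c + 1) i.succAbove id (Fin.strictMono_succAbove i) strictMono_id
    have hterm : ∀ i ∈ (Finset.univ : Finset (Fin (c + 2))),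
        0 ≤ s * ((-1) ^ (i : ℕ) * M i 0 * (M.submatrix i.succAbove Fin.succ).det) := by
      intro i _
      have := mul_nonneg (hs i).le (hmin i)
      have e : M i 0 = ∑ l, A i l * x l := rfl
      rw [e]
      linarith
    have hsum : ∑ i : Fin (c + 2), s * ((-1) ^ (i : ℕ) * M i 0 * (M.submatrix i.succAbove Fin.succ).det) = 0 := by
      rw [← Finset.mul_sum, hM, mul_zero]
    have hz := (Finset.sum_eq_zero_iff_of_nonneg hterm).mp hsum (Fin.last _) (Finset.mem_univ _)
    have hdet : (M.submatrix (Fin.last (c + 1)).succAbove Fin.succ).det = 0 := by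
      have h1 := (hs (Fin.last _)).ne'
      have e : M (Fin.last _) 0 = ∑ l, A (Fin.last _) l * x l := rfl
      rw [e, ← mul_assoc, ← mul_assoc] at hz
      exact (mul_eq_zero.mp hz).resolve_left h1
    obtain ⟨v, hv0, hv⟩ := Matrix.exists_mulVec_eq_zero_iff.mpr hdet
    have hv' : ∀ i : Fin (c + 1), ∑ k, B i.castSucc k * v k = 0 := by
      intro i
      have := congrFun hv i
      simpa [Matrix.mulVec, dotProduct, M] using this
    obtain ⟨l0, -, hl0⟩ := Finset.exists_max_image (Finset.univ : Finset (Fin (c + 1)))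
      (fun l => |v l|) Finset.univ_nonempty
    have hvl0 : v l0 ≠ 0 := by
      intro h
      apply hv0
      ext l
      have := hl0 l (Finset.mem_univ l)
      rw [h, abs_zero] at this
      exact abs_nonpos_iff.mp this
    let τ : ℝ := u l0 / v l0
    let u' : Fin (c + 1) → ℝ := fun l => u l - τ * v l
    have hu'0 : u' l0 = 0 := by simp only [u', τ]; field_simp; ring
    have hτ : ∀ l, |τ * v l| ≤ 1 := by
      intro l
      simp only [τ]
      rw [abs_mul, abs_div, habs, one_div, inv_mul_le_iff₀ (abs_pos.mpr hvl0), mul_one]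
      exact hl0 l (Finset.mem_univ l)
    have hu's : ∀ l : Fin (c + 1), 0 ≤ t * (-1) ^ (l : ℕ) * u' l := by
      intro l
      have h1 : |u l * (τ * v l)| ≤ 1 := by
        rw [abs_mul, habs, one_mul]; exact hτ l
      have h2 := hu1 l
      have h3 := (abs_le.mp h1).2
      show 0 ≤ u l * (u l - τ * v l)
      linarith
    have hs' : ∀ i : Fin (c + 1), 0 < s * (-1) ^ (i : ℕ) * ∑ l, B i.castSucc l * u' l := by
      intro i
      have h1 := hs i.castSucc
      have h2 : ∑ l, B i.castSucc l * u' l = ∑ l, A i.castSucc l * x l := by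
        rw [← hBu]
        simp only [u', mul_sub, Finset.sum_sub_distrib]
        have : ∑ l, B i.castSucc l * (τ * v l) = τ * ∑ k, B i.castSucc k * v k := by
          rw [Finset.mul_sum]; exact Finset.sum_congr rfl fun _ _ => by ring
        rw [this, hv', mul_zero, sub_zero]
      rw [h2]; exact h1
    have hTP' : ∀ (k : ℕ) (f : Fin k → Fin (c + 1)) (g : Fin k → Fin (c + 1)),
        StrictMono f → StrictMono g →
        0 ≤ Matrix.det (Matrix.of fun i j : Fin k => B (f i).castSucc (g j)) :=
      fun k f g hf hg => hB k (fun i => (f i).castSucc) g (fun i j h => hf h) hg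
    by_cases hl : (l0 : ℕ) = 0
    · refine ih (c + 1) (fun i l => B i.castSucc l) hTP' u' (fun l => (l : ℕ) - 1) ?_ ?_ (-t) ?_ ?_ s hs'
      · intro i j h
        have : (i : ℕ) ≤ j := h
        show (i : ℕ) - 1 ≤ j - 1
        omega
      · intro l h
        have : (l : ℕ) ≠ 0 := fun h' => h (by rw [← hu'0]; congr 1; exact Fin.ext (by omega))
        show (l : ℕ) - 1 < c
        omega
      · linarith
      · intro l
        by_cases h' : (l : ℕ) = 0
        · have : l = l0 := Fin.ext (by omega)
          rw [this, hu'0, mul_zero]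
        · have h1 := hu's l
          obtain ⟨m, hm⟩ := Nat.exists_eq_succ_of_ne_zero h'
          rw [hm, pow_succ] at h1
          have e : (l : ℕ) - 1 = m := by omega
          show 0 ≤ -t * (-1) ^ ((l : ℕ) - 1) * u' l
          rw [e]
          linarith
    · refine ih (c + 1) (fun i l => B i.castSucc l) hTP' u'
        (fun l => if (l : ℕ) < l0 then (l : ℕ) else if (l : ℕ) = l0 then (l0 : ℕ) - 1 else (l : ℕ) - 2)
        ?_ ?_ t ht ?_ s hs'
      · intro i j h
        have : (i : ℕ) ≤ j := h
        dsimp only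
        split_ifs <;> omega
      · intro l h
        have : (l : ℕ) ≠ l0 := fun h' => h (by rw [← hu'0]; congr 1; exact Fin.ext h')
        split_ifs <;> omega
      · intro l
        by_cases h' : (l : ℕ) = l0
        · rw [Fin.ext h', hu'0, mul_zero]
        · have h1 := hu's l
          split_ifs with h2
          · exact h1
          · obtain ⟨m, hm⟩ : ∃ m, (l : ℕ) = m + 2 := ⟨(l : ℕ) - 2, by omega⟩
            have e : (l : ℕ) - 2 = m := by omega
            rw [e]
            rw [hm, pow_add] at h1
            simpa using h1

theorem totallyPos_C (c : ℝ) (hc : 0 ≤ c) :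
    TotallyPos (fun i j => if j ≤ i then (Polynomial.C c).coeff (i - j) else 0) := by
  intro k f g hf hg
  have e : (Matrix.of fun i j : Fin k =>
      (fun i j => if j ≤ i then (Polynomial.C c).coeff (i - j) else 0) (f i) (g j))
      = c • (Matrix.of fun i j : Fin k => if g j = f i then (1 : ℝ) else 0) := by
    ext i j
    simp only [Matrix.of_apply, Matrix.smul_apply, smul_eq_mul, Polynomial.coeff_C]
    split_ifs <;> first | omega | simp
  rw [e, Matrix.det_smul]
  refine mul_nonneg (pow_nonneg hc _) ?_
  by_cases h : ∀ j, ∃ i, f i = g j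
  · choose φ hφ using h
    have hinj : Function.Injective φ := by
      intro i j hij
      apply hg.injective
      rw [← hφ, ← hφ, hij]
    have hsurj : Function.Surjective φ := Finite.surjective_of_injective hinj
    have hr : Set.range f = Set.range g := by
      ext m
      constructor
      · rintro ⟨i, rfl⟩
        obtain ⟨j, rfl⟩ := hsurj i
        exact ⟨j, (hφ j).symm⟩
      · rintro ⟨j, rfl⟩
        exact ⟨φ j, hφ j⟩
    have hfg : f = g := (hf.range_inj hg).mp hr
    subst hfg
    have : (Matrix.of fun i j : Fin k => if f j = f i then (1 : ℝ) else 0) = 1 := by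
      ext i j
      simp [Matrix.one_apply, hf.injective.eq_iff, eq_comm]
    rw [this, Matrix.det_one]
    exact zero_le_one
  · push Not at h
    obtain ⟨j, hj⟩ := h
    rw [Matrix.det_eq_zero_of_column_eq_zero j]
    intro i
    simp only [Matrix.of_apply]
    rw [if_neg (fun h => hj i h.symm)]

theorem totallyPos_mul (q : Polynomial ℝ) (r : ℝ) (hr : r ≤ 0)
    (hq : TotallyPos (fun i j => if j ≤ i then q.coeff (i - j) else 0)) :
    TotallyPos (fun i j => if j ≤ i then
      (q * (Polynomial.X - Polynomial.C r)).coeff (i - j) else 0) := by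
  intro k f g hf hg
  let T : ℕ → ℕ → ℝ := fun i j => if j ≤ i then q.coeff (i - j) else 0
  have key := det_nonneg_of_sum (k := k) (ι := Bool) (fun _ e => if e then 1 else -r)
    (fun j e i => T (f i) (g j + if e then 1 else 0))
    (fun j e => by cases e <;> simp [hr]) (by
      intro φ _
      by_cases hm : StrictMono (fun j => g j + if φ j then 1 else 0)
      · exact hq k f _ hf hm
      · unfold StrictMono at hm
        push Not at hm
        obtain ⟨i, j, hij, hle⟩ := hm
        have h1 := hg hij
        have h2 : (g i + if φ i then 1 else 0) = g j + if φ j then 1 else 0 := by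
          revert hle
          split_ifs <;> intro hle <;> omega
        rw [Matrix.det_zero_of_column_eq hij.ne]
        intro l
        simp only [Matrix.of_apply]
        rw [h2])
  convert key using 3
  ext i j
  simp only [Matrix.of_apply]
  simp only [Fintype.sum_bool, if_true, T]
  rcases lt_trichotomy (g j) (f i) with h | h | h
  · obtain ⟨m, hm⟩ : ∃ m, f i = g j + 1 + m := ⟨f i - (g j + 1), by omega⟩
    have e1 : f i - g j = m + 1 := by omega
    have e2 : f i - (g j + 1) = m := by omega
    rw [if_pos h.le, e1, Polynomial.coeff_mul_X_sub_C]
    simp [h.le, e1, e2, Nat.succ_le_of_lt h]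
    ring
  · simp [h, mul_sub, Polynomial.mul_coeff_zero]
    ring
  · simp [not_le.mpr h, show ¬ (g j + 1 ≤ f i) by omega]

theorem totallyPos_of_splits (p : Polynomial ℝ) (hp : p.Splits) (hnn : ∀ k, 0 ≤ p.coeff k) :
    TotallyPos (fun i j => if j ≤ i then p.coeff (i - j) else 0) := by
  have hroots : ∀ r ∈ p.roots, r ≤ 0 := by
    intro r hr
    by_contra hpos
    push Not at hpos
    have hp0 : p ≠ 0 := Polynomial.ne_zero_of_mem_roots hr
    have h0 : p.eval r = 0 := (Polynomial.mem_roots hp0).mp hr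
    rw [Polynomial.eval_eq_sum_range] at h0
    have h1 := (Finset.sum_eq_zero_iff_of_nonneg (fun i _ =>
      mul_nonneg (hnn i) (pow_nonneg hpos.le i))).mp h0 p.natDegree (by simp)
    rcases mul_eq_zero.mp h1 with h | h
    · exact hp0 (Polynomial.leadingCoeff_eq_zero.mp h)
    · exact (pow_pos hpos _).ne' h
  have main : ∀ s : Multiset ℝ, (∀ r ∈ s, r ≤ 0) →
      TotallyPos (fun i j => if j ≤ i then (Polynomial.C p.leadingCoeff *
        (s.map fun r => Polynomial.X - Polynomial.C r).prod).coeff (i - j) else 0) := by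
    intro s
    induction s using Multiset.induction_on with
    | empty =>
      intro _
      simpa using totallyPos_C p.leadingCoeff (hnn _)
    | cons r s ih =>
      intro hs
      have := totallyPos_mul _ r (hs r (by simp)) (ih fun x hx => hs x (by simp [hx]))
      rw [Multiset.map_cons, Multiset.prod_cons, mul_comm (Polynomial.X - Polynomial.C r),
        ← mul_assoc]
      exact this
  have := main p.roots hroots
  rwa [← hp.eq_prod_roots] at this

theorem toeplitz_sum (n N i : ℕ) (a : ℕ → ℝ) (hz : ∀ k, n < k → a k = 0) (x : ℕ → ℝ)
    (hn : n ≤ i) (hi : i < N) :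
    ∑ l : Fin N, (if (l : ℕ) ≤ i then a (i - l) else 0) * x l
      = ∑ k ∈ Finset.range (n + 1), a k * x (i - k) := by
  rw [Fin.sum_univ_eq_sum_range (fun l => (if l ≤ i then a (i - l) else 0) * x l) N]
  have h1 : ∑ l ∈ Finset.range N, (if l ≤ i then a (i - l) else 0) * x l
      = ∑ l ∈ Finset.range (i + 1), a (i - l) * x l := by
    rw [← Finset.sum_subset (Finset.range_mono (show i + 1 ≤ N from hi))]
    · refine Finset.sum_congr rfl fun l hl => ?_
      rw [if_pos (by simpa [Nat.lt_succ_iff] using hl)]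
    · intro l _ hl
      rw [if_neg (by simpa [Nat.lt_succ_iff] using hl), zero_mul]
  have h2 : ∑ k ∈ Finset.range (n + 1), a k * x (i - k)
      = ∑ k ∈ Finset.range (i + 1), a k * x (i - k) := by
    refine Finset.sum_subset (Finset.range_mono (by omega)) ?_
    intro k _ hk
    rw [hz k (by simpa using hk), zero_mul]
  rw [h1, h2, ← Finset.sum_range_reflect]
  refine Finset.sum_congr rfl fun k hk => ?_
  have : k ≤ i := by simpa [Nat.lt_succ_iff] using hk
  rw [show i + 1 - 1 - k = i - k by omega, show i - (i - k) = k by omega]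

theorem shift_sum {K : Type*} [Field K] (n i : ℕ) (a : ℕ → K) (r : K) (hr : r ≠ 0) (hn : n ≤ i) :
    ∑ k ∈ Finset.range (n + 1), a k * r⁻¹ ^ (i - k)
      = (∑ k ∈ Finset.range (n + 1), a k * r ^ k) * r⁻¹ ^ i := by
  rw [Finset.sum_mul]
  refine Finset.sum_congr rfl fun k hk => ?_
  have hk' : k ≤ i := by
    have := Finset.mem_range.mp hk
    omega
  obtain ⟨m, rfl⟩ := Nat.exists_eq_add_of_le hk'
  rw [show k + m - k = m by omega, pow_add, mul_assoc, ← mul_assoc (r ^ k), ← mul_pow,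
    mul_inv_cancel₀ hr, one_pow, one_mul]

theorem no_lower_root (n : ℕ) (a : ℕ → ℝ) (hz : ∀ k, n < k → a k = 0)
    (hT : TotallyPos (fun i j => if j ≤ i then a (i - j) else 0))
    (σ : ℝ) (hσ : 0 < σ) (hP : ∑ k ∈ Finset.range (n + 1), a k * (-σ) ^ k ≠ 0)
    (z : ℂ) (him : z.im < 0) (hroot : ∑ k ∈ Finset.range (n + 1), (a k : ℂ) * z ^ k = 0) :
    False := by
  have hz0 : z ≠ 0 := by rintro rfl; simp at him
  set w : ℂ := z⁻¹ with hw
  have hwim : 0 < w.im := by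
    rw [hw, Complex.inv_im]
    exact div_pos (by linarith) (Complex.normSq_pos.mpr hz0)
  have hw0 : w ≠ 0 := inv_ne_zero hz0
  set θ : ℝ := w.arg with hθ
  have hθ0 : 0 < θ := by
    rcases (Complex.arg_nonneg_iff.mpr hwim.le).lt_or_eq with h | h
    · exact h
    · have := Complex.arg_eq_zero_iff.mp h.symm
      exact absurd this.2 hwim.ne'
  have hθπ : θ < Real.pi := by
    rcases (Complex.arg_le_pi w).lt_or_eq with h | h
    · exact h
    · have := Complex.arg_eq_pi_iff.mp h
      exact absurd this.2 hwim.ne'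
  have hπ := Real.pi_pos
  obtain ⟨c, hc⟩ := exists_nat_ge ((Real.pi + (n + 1) * θ) / (Real.pi - θ))
  rw [div_le_iff₀ (by linarith)] at hc
  -- a generic phase
  obtain ⟨φ, hφ, hφ0, hφπ⟩ : ∃ φ : ℝ, (∀ j m : ℕ, φ + j * θ ≠ m * Real.pi) ∧ 0 < φ ∧ φ < Real.pi := by
    have hcount : (Set.range (fun q : ℕ × ℕ => (q.2 : ℝ) * Real.pi - q.1 * θ)).Countable :=
      Set.countable_range _
    obtain ⟨φ, h1, h2⟩ := (hcount.dense_compl ℝ).exists_mem_open isOpen_Ioo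
      (Set.nonempty_Ioo.mpr hπ)
    refine ⟨φ, fun j m h => h1 ⟨(j, m), ?_⟩, h2.1, h2.2⟩
    show (m : ℝ) * Real.pi - j * θ = φ
    linarith
  let b : ℕ → ℕ := fun j => ⌊(φ + j * θ) / Real.pi⌋₊
  let I : ℕ → ℝ := fun j => (Complex.exp (φ * Complex.I) * w ^ j).im
  have hI : ∀ j, I j = ‖w‖ ^ j * Real.sin (φ + j * θ) := by
    intro j
    have h1 : Complex.exp (φ * Complex.I) * w ^ j
        = ((‖w‖ ^ j : ℝ) : ℂ) * Complex.exp (((φ + j * θ : ℝ) : ℂ) * Complex.I) := by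
      conv_lhs => rw [← Complex.norm_mul_exp_arg_mul_I w]
      rw [mul_pow, ← Complex.exp_nat_mul, mul_left_comm, ← Complex.exp_add]
      push_cast
      congr 2
      ring
    show (Complex.exp (φ * Complex.I) * w ^ j).im = _
    rw [h1, Complex.im_ofReal_mul, Complex.exp_ofReal_mul_I_im]
  have hIpos : ∀ j, 0 < (-1) ^ (b j) * I j := by
    intro j
    have hnn : 0 ≤ (φ + j * θ) / Real.pi := by positivity
    have h1 : (b j : ℝ) * Real.pi ≤ φ + j * θ := (le_div_iff₀ hπ).mp (Nat.floor_le hnn)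
    have h2 : φ + j * θ < ((b j : ℝ) + 1) * Real.pi := (div_lt_iff₀ hπ).mp (Nat.lt_floor_add_one _)
    have h3 := hφ j (b j)
    have h4 : (b j : ℝ) * Real.pi < φ + j * θ := lt_of_le_of_ne h1 (Ne.symm h3)
    have h5 : 0 < Real.sin (φ + j * θ - b j * Real.pi) :=
      Real.sin_pos_of_pos_of_lt_pi (by linarith) (by linarith)
    rw [Real.sin_sub_nat_mul_pi] at h5
    rw [hI, mul_left_comm]
    exact mul_pos (pow_pos (norm_pos_iff.mpr hw0) _) h5
  -- a small perturbation
  obtain ⟨ε, hε0, hε⟩ : ∃ ε : ℝ, 0 < ε ∧ ∀ j ∈ Finset.range (n + c + 1),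
      0 < (-1) ^ (b j) * (I j + ε * (-σ)⁻¹ ^ j) := by
    have hev : ∀ᶠ ε in nhdsWithin (0 : ℝ) (Set.Ioi 0), ∀ j ∈ Finset.range (n + c + 1),
        0 < (-1) ^ (b j) * (I j + ε * (-σ)⁻¹ ^ j) := by
      rw [Filter.eventually_all_finset]
      intro j _
      apply Filter.Eventually.filter_mono nhdsWithin_le_nhds
      have hcont : Continuous (fun ε : ℝ => (-1) ^ (b j) * (I j + ε * (-σ)⁻¹ ^ j)) := by fun_prop
      refine hcont.continuousAt.eventually (lt_mem_nhds ?_)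
      simpa using hIpos j
    obtain ⟨ε, h1, h2⟩ := (hev.and self_mem_nhdsWithin).exists
    exact ⟨ε, h2, h1⟩
  set P := ∑ k ∈ Finset.range (n + 1), a k * (-σ) ^ k with hPdef
  let x : ℕ → ℝ := fun j => I j + ε * (-σ)⁻¹ ^ j
  have hy : ∀ i, n ≤ i → ∑ k ∈ Finset.range (n + 1), a k * x (i - k) = ε * (P * (-σ)⁻¹ ^ i) := by
    intro i hi
    have h1 : ∑ k ∈ Finset.range (n + 1), a k * I (i - k) = 0 := by
      have h2 := shift_sum n i (fun k => (a k : ℂ)) z hz0 hi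
      rw [hroot, zero_mul] at h2
      have h3 := congrArg (fun t => (Complex.exp (φ * Complex.I) * t).im) h2
      simp only [mul_zero, Complex.zero_im] at h3
      rw [Finset.mul_sum, Complex.im_sum] at h3
      rw [← h3]
      refine Finset.sum_congr rfl fun k _ => ?_
      rw [mul_left_comm, Complex.im_ofReal_mul]
    have h2 := shift_sum n i a (-σ) (by linarith) hi
    rw [← hPdef] at h2
    have h3 : ∑ k ∈ Finset.range (n + 1), a k * x (i - k)
        = ∑ k ∈ Finset.range (n + 1), a k * I (i - k)
          + ε * ∑ k ∈ Finset.range (n + 1), a k * (-σ)⁻¹ ^ (i - k) := by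
      rw [Finset.mul_sum, ← Finset.sum_add_distrib]
      refine Finset.sum_congr rfl fun k _ => ?_
      simp only [x]
      ring
    rw [h3, h1, h2, zero_add]
  refine varDim c (n + c + 1) (fun i l => if (l : ℕ) ≤ n + i then a (n + i - l) else 0) ?_
    (fun l => x l) (fun l => b l) ?_ ?_ 1 (by norm_num) ?_ (P * (-1) ^ n) ?_
  · intro k f g hf hg
    exact hT k (fun i => n + f i) (fun j => g j)
      (fun i j h => Nat.add_lt_add_left (hf h) n) (fun i j h => hg h)
  · intro i j h
    have h' : ((i : ℕ) : ℝ) ≤ (j : ℕ) := by exact_mod_cast h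
    apply Nat.floor_mono
    gcongr
  · intro l _
    show ⌊(φ + (l : ℕ) * θ) / Real.pi⌋₊ < c
    rw [Nat.floor_lt (by positivity), div_lt_iff₀ hπ]
    have h' : ((l : ℕ) : ℝ) ≤ n + c + 1 := by exact_mod_cast l.2.le
    nlinarith [mul_le_mul_of_nonneg_right h' hθ0.le]
  · intro l
    have := hε l (Finset.mem_range.mpr l.2)
    rw [one_mul]
    exact this.le
  · intro i
    rw [toeplitz_sum n (n + c + 1) (n + i) a hz x (by omega) (by omega), hy _ (by omega)]
    have e : P * (-1) ^ n * (-1) ^ (i : ℕ) * (ε * (P * (-σ)⁻¹ ^ (n + (i : ℕ))))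
        = ε * (P * P) * σ⁻¹ ^ (n + (i : ℕ)) := by
      have h1 : ((-1 : ℝ) ^ (n + (i : ℕ))) * (-σ)⁻¹ ^ (n + (i : ℕ)) = σ⁻¹ ^ (n + (i : ℕ)) := by
        rw [← mul_pow, inv_neg]; ring
      rw [← h1, pow_add (-1 : ℝ)]
      ring
    rw [e]
    have := mul_self_pos.mpr hP
    positivity

/-- A finite sequence of nonnegative reals `a_0,…,a_n` is a Pólya frequency
sequence (its Toeplitz matrix `[a_{i-j}]` is totally positive) iff the
polynomial `a_0 + a_1 x + ⋯ + a_n x^n` is constant or has only real roots. -/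
theorem PF_iff_realRooted (n : ℕ) (a : ℕ → ℝ)
    (hnn : ∀ k, 0 ≤ a k) (hz : ∀ k, n < k → a k = 0) :
    TotallyPos (fun i j => if j ≤ i then a (i - j) else 0) ↔
      RealRooted (∑ k ∈ Finset.range (n + 1), Polynomial.C (a k) * Polynomial.X ^ k) := by
  set p := ∑ k ∈ Finset.range (n + 1), Polynomial.C (a k) * Polynomial.X ^ k with hp
  have hcoeff : ∀ k, p.coeff k = a k := by
    intro k
    rw [hp, Polynomial.finsetSum_coeff]
    simp only [Polynomial.coeff_C_mul_X_pow]
    by_cases hk : k < n + 1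
    · simp [hk]
    · rw [hz k (by omega)]
      refine Finset.sum_eq_zero fun j hj => ?_
      have := Finset.mem_range.mp hj
      rw [if_neg (by omega)]
  have haeval : ∀ z : ℂ, Polynomial.aeval z p
      = ∑ k ∈ Finset.range (n + 1), (a k : ℂ) * z ^ k := by
    intro z
    simp [hp]
  constructor
  · intro hT
    by_cases hd : p.natDegree = 0
    · exact Or.inl hd
    · right
      have hp0 : p ≠ 0 := by rintro h; simp [h] at hd
      obtain ⟨σ, hσ, hP⟩ : ∃ σ : ℝ, 0 < σ ∧ ∑ k ∈ Finset.range (n + 1), a k * (-σ) ^ k ≠ 0 := by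
        obtain ⟨r, hr, hr'⟩ := (Set.Iio_infinite (0 : ℝ)).exists_notMem_finset p.roots.toFinset
        refine ⟨-r, by simpa using hr, fun h => hr' ?_⟩
        rw [Multiset.mem_toFinset, Polynomial.mem_roots hp0]
        show p.eval r = 0
        rw [← h]
        simp [hp, Polynomial.eval_finsetSum]
      intro z hroot
      rw [haeval] at hroot
      rcases lt_trichotomy z.im 0 with h | h | h
      · exact (no_lower_root n a hz hT σ hσ hP z h hroot).elim
      · exact h
      · refine (no_lower_root n a hz hT σ hσ hP ((starRingEnd ℂ) z) (by simpa using h) ?_).elim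
        have := congrArg (starRingEnd ℂ) hroot
        simpa using this
  · intro hR
    have hsplit : p.Splits := by
      rcases hR with hd | hR
      · rw [Polynomial.eq_C_of_natDegree_eq_zero hd]
        exact Polynomial.Splits.C _
      · refine Polynomial.Splits.of_splits_map (algebraMap ℝ ℂ) (IsAlgClosed.splits _) ?_
        intro z hzr
        have h1 := Polynomial.isRoot_of_mem_roots hzr
        have h2 : Polynomial.aeval z p = 0 := by
          rw [Polynomial.aeval_def, ← Polynomial.eval_map]; exact h1
        exact ⟨z.re, Complex.ext rfl (by simpa using (hR z h2).symm)⟩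
    have := totallyPos_of_splits p hsplit (fun k => by rw [hcoeff]; exact hnn k)
    simpa only [hcoeff] using this
end

section
/- Let A = [a_{n,k}]_{n,k≥0} be an infinite lower triangular matrix with nonzero diagonals whose left production matrix Q(A) is totally positive. Then the reversal matrix [a_{n,n-k}]_{n,k≥0} (with entries 0 when k > n) is totally positive. -/
/-- `blockOne M = blockdiag(1, M)`. -/
def blockOne (M : ℕ → ℕ → ℝ) : ℕ → ℕ → ℝ :=
  fun i k =>
    if i = 0 then (if k = 0 then 1 else 0)
    else if k = 0 then 0 else M (i - 1) (k - 1)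


open Matrix in
lemma det_mul_expand {k : ℕ} {ι : Type*} [Fintype ι] [DecidableEq ι]
    (X : Matrix (Fin k) ι ℝ) (Y : Matrix ι (Fin k) ℝ) :
    (X * Y).det = ∑ p : Fin k → ι, (∏ i, X i (p i)) * (Y.submatrix p id).det := by
  have h : (X * Y) = fun i => ∑ q, X i q • Y q := by
    ext i j
    simp [Matrix.mul_apply, Finset.sum_apply]
  have h2 := (Matrix.detRowAlternating (n := Fin k) (R := ℝ)).toMultilinearMap.map_sum
    (fun i (q : ι) => X i q • Y q)
  have h3 : (X * Y).det = ∑ p : Fin k → ι,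
      (Matrix.detRowAlternating (n := Fin k) (R := ℝ)).toMultilinearMap
        (fun i => X i (p i) • Y (p i)) := by
    rw [← h2, h]; rfl
  rw [h3]
  refine Finset.sum_congr rfl fun p _ => ?_
  rw [MultilinearMap.map_smul_univ]
  rfl

open Matrix in
lemma factorial_det_mul {k : ℕ} {ι : Type*} [Fintype ι] [DecidableEq ι]
    (X : Matrix (Fin k) ι ℝ) (Y : Matrix ι (Fin k) ℝ) :
    (Fintype.card (Equiv.Perm (Fin k)) : ℝ) * (X * Y).det
      = ∑ p : Fin k → ι, (X.submatrix id p).det * (Y.submatrix p id).det := by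
  have h1 : ∀ p : Fin k → ι, (X.submatrix id p).det * (Y.submatrix p id).det
      = ∑ σ : Equiv.Perm (Fin k),
        (∏ i, X i ((p ∘ σ) i)) * (Y.submatrix (p ∘ σ) id).det := by
    intro p
    rw [← Matrix.det_transpose, Matrix.det_apply', Finset.sum_mul]
    refine Finset.sum_congr rfl fun σ _ => ?_
    have : Y.submatrix (p ∘ σ) id = (Y.submatrix p id).submatrix σ id := rfl
    rw [this, Matrix.det_permute]
    simp only [Matrix.transpose_apply, Matrix.submatrix_apply, id, Function.comp]
    ring
  simp_rw [h1]
  rw [Finset.sum_comm]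
  have h2 : ∀ σ : Equiv.Perm (Fin k), ∑ p : Fin k → ι,
      (∏ i, X i ((p ∘ σ) i)) * (Y.submatrix (p ∘ σ) id).det = (X * Y).det := by
    intro σ
    rw [det_mul_expand]
    exact (Equiv.sum_comp (Equiv.arrowCongr σ.symm (Equiv.refl ι))
      (fun p : Fin k → ι => (∏ i, X i (p i)) * (Y.submatrix p id).det))
  simp_rw [h2]
  simp

lemma TotallyPos.mul {B C : ℕ → ℕ → ℝ} (hB : TotallyPos B) (hC : TotallyPos C)
    (htri : ∀ n k, n < k → B n k = 0) :
    TotallyPos (fun n m => ∑ i ∈ Finset.range (n + 1), B n i * C i m) := by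
  intro k f g hf hg
  obtain ⟨N, hN⟩ : ∃ N, ∀ i, f i < N :=
    ⟨Finset.univ.sup f + 1, fun i => Nat.lt_succ_of_le (Finset.le_sup (Finset.mem_univ i))⟩
  let X : Matrix (Fin k) (Fin N) ℝ := fun i q => B (f i) q
  let Y : Matrix (Fin N) (Fin k) ℝ := fun q j => C q (g j)
  have hXY : (Matrix.of fun i j : Fin k =>
      ∑ q ∈ Finset.range (f i + 1), B (f i) q * C q (g j)) = X * Y := by
    ext i j
    rw [Matrix.mul_apply]
    simp only [Matrix.of_apply, X, Y]
    rw [Fin.sum_univ_eq_sum_range (fun q => B (f i) q * C q (g j)) N]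
    refine Finset.sum_subset ?_ ?_
    · intro q hq
      have := hN i
      simp only [Finset.mem_range] at *
      omega
    · intro q _ hq
      rw [htri _ _ (by simpa using hq), zero_mul]
  change 0 ≤ (Matrix.of fun i j : Fin k =>
      ∑ q ∈ Finset.range (f i + 1), B (f i) q * C q (g j)).det
  rw [hXY]
  have hc : (0 : ℝ) < (Fintype.card (Equiv.Perm (Fin k)) : ℝ) := by
    exact_mod_cast Fintype.card_pos
  refine nonneg_of_mul_nonneg_right (a := (Fintype.card (Equiv.Perm (Fin k)) : ℝ)) ?_ hc
  rw [factorial_det_mul]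
  refine Finset.sum_nonneg fun p _ => ?_
  by_cases hp : Function.Injective p
  · let σ := Tuple.sort p
    have hm : StrictMono (p ∘ σ) :=
      (Tuple.monotone_sort p).strictMono_of_injective (hp.comp σ.injective)
    have hm' : StrictMono (fun i => ((p (σ i) : Fin N) : ℕ)) := fun a b hab => hm hab
    have e1 := Matrix.det_permute' σ (X.submatrix id p)
    have e2 := Matrix.det_permute σ (Y.submatrix p id)
    have n1 := hB k f _ hf hm'
    have n2 := hC k _ g hm' hg
    have n1' : 0 ≤ ((X.submatrix id p).submatrix id σ).det := n1
    have n2' : 0 ≤ ((Y.submatrix p id).submatrix σ id).det := n2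
    have := mul_nonneg n1' n2'
    rw [e1, e2] at this
    rcases Int.units_eq_one_or (Equiv.Perm.sign σ) with h | h <;> rw [h] at this <;>
      simpa using this
  · have : (Y.submatrix p id).det = 0 := by
      simp only [Function.Injective, not_forall] at hp
      obtain ⟨a, b, hab, hne⟩ := hp
      refine Matrix.det_zero_of_row_eq hne ?_
      ext j
      simp [hab]
    rw [this, mul_zero]

lemma TotallyPos.blockOne {M : ℕ → ℕ → ℝ} (hM : TotallyPos M) : TotallyPos (blockOne M) := by
  have key : ∀ (k : ℕ) (f g : Fin k → ℕ), StrictMono f → StrictMono g →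
      (∀ i, f i ≠ 0) → (∀ i, g i ≠ 0) →
      0 ≤ Matrix.det (Matrix.of fun i j : Fin k => _root_.blockOne M (f i) (g j)) := by
    intro k f g hf hg hf0 hg0
    have := hM k (fun i => f i - 1) (fun i => g i - 1)
      (fun a b hab => by have := hf hab; have := hf0 a; have := hf0 b; grind)
      (fun a b hab => by have := hg hab; have := hg0 a; have := hg0 b; grind)
    simpa [_root_.blockOne, hf0, hg0] using this
  intro k f g hf hg
  cases k with
  | zero => simp
  | succ k =>
    have hpos : ∀ (f : Fin (k + 1) → ℕ), StrictMono f → ∀ i : Fin k, f i.succ ≠ 0 := by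
      intro f hf i
      have := hf (Fin.succ_pos i)
      omega
    have hpos' : ∀ (f : Fin (k + 1) → ℕ), StrictMono f → f 0 ≠ 0 → ∀ i, f i ≠ 0 := by
      intro f hf h0 i
      have := hf.monotone (Fin.zero_le i)
      omega
    by_cases hf0 : f 0 = 0
    · by_cases hg0 : g 0 = 0
      · rw [Matrix.det_succ_row_zero, Finset.sum_eq_single 0]
        · have := key k (fun i => f i.succ) (fun i => g i.succ)
            (hf.comp (Fin.strictMono_succ)) (hg.comp (Fin.strictMono_succ)) (hpos f hf) (hpos g hg)
          simpa [_root_.blockOne, hf0, hg0, Matrix.submatrix] using this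
        · intro j _ hj
          obtain ⟨j, rfl⟩ := Fin.exists_succ_eq.mpr hj
          simp [_root_.blockOne, hf0, hpos g hg j]
        · simp
      · rw [Matrix.det_eq_zero_of_row_eq_zero 0]
        intro j
        simp [_root_.blockOne, hf0, hpos' g hg hg0 j]
    · by_cases hg0 : g 0 = 0
      · rw [Matrix.det_eq_zero_of_column_eq_zero 0]
        intro j
        simp [_root_.blockOne, hg0, hpos' f hf hf0 j]
      · exact key _ f g hf hg (hpos' f hf hf0) (hpos' g hg hg0)

/-- Rows `0..s` of `Q`, followed by unit rows `e_{p-1}` for `p > s`. -/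
noncomputable def extMat (Q : ℕ → ℕ → ℝ) (s : ℕ) : ℕ → ℕ → ℝ :=
  fun p i => if p ≤ s then Q p i else if i + 1 = p then 1 else 0

lemma extMat_tri {Q : ℕ → ℕ → ℝ} (hQtri : ∀ n k, n < k → Q n k = 0) (s : ℕ) :
    ∀ n k, n < k → extMat Q s n k = 0 := by
  intro n k h
  unfold extMat
  split_ifs
  · exact hQtri _ _ h
  · omega
  · rfl

lemma extMat_totallyPos {Q : ℕ → ℕ → ℝ} (hQtri : ∀ n k, n < k → Q n k = 0)
    (hQ : TotallyPos Q) (s : ℕ) : TotallyPos (extMat Q s) := by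
  intro k
  induction k with
  | zero => intro f g _ _; simp
  | succ k ih =>
    intro f g hf hg
    by_cases hl : f (Fin.last k) ≤ s
    · have h : ∀ i, f i ≤ s := fun i => (hf.monotone (Fin.le_last i)).trans hl
      simpa [extMat, h] using hQ _ f g hf hg
    · by_cases hg1 : f (Fin.last k) ≤ g (Fin.last k)
      · rw [Matrix.det_eq_zero_of_column_eq_zero (Fin.last k)]
        intro i
        have := hf.monotone (Fin.le_last i)
        simp only [Matrix.of_apply, extMat]
        split_ifs
        · exact hQtri _ _ (by omega)
        · omega
        · rfl
      · rw [Matrix.det_succ_row _ (Fin.last k), Finset.sum_eq_single (Fin.last k)]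
        · have h1 := ih (fun i => f i.castSucc) (fun i => g i.castSucc)
            (hf.comp (Fin.strictMono_castSucc)) (hg.comp (Fin.strictMono_castSucc))
          have h2 : 0 ≤ extMat Q s (f (Fin.last k)) (g (Fin.last k)) := by
            simp only [extMat, hl, if_false]
            split_ifs <;> norm_num
          simpa [Matrix.submatrix, ← two_mul] using mul_nonneg h2 h1
        · intro j _ hj
          have : g j < g (Fin.last k) := hg (Fin.lt_last_iff_ne_last.mpr hj)
          have h : extMat Q s (f (Fin.last k)) (g j) = 0 := by
            simp only [extMat, hl, if_false]
            rw [if_neg (by omega)]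
          simp [h]
        · simp

/-- Rows `A_0, …, A_s, x A_{s-1}, x² A_{s-2}, …, x^s A_0`, then zero rows. -/
noncomputable def stack (A : ℕ → ℕ → ℝ) (s : ℕ) : ℕ → ℕ → ℝ :=
  fun p m => if p ≤ s then A p m
    else if p ≤ 2 * s ∧ p - s ≤ m then A (2 * s - p) (m - (p - s)) else 0

lemma stack_succ {A Q : ℕ → ℕ → ℝ}
    (hprod : ∀ n k, A n k = ∑ i ∈ Finset.range (n + 1), Q n i * blockOne A i k) (s : ℕ) :
    stack A (s + 1) = fun n m => ∑ i ∈ Finset.range (n + 1),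
      extMat Q (s + 1) n i * blockOne (stack A s) i m := by
  funext n m
  by_cases hn : n ≤ s + 1
  · simp only [extMat, stack, hn, if_true]
    rw [hprod]
    refine Finset.sum_congr rfl fun i hi => ?_
    simp only [Finset.mem_range] at hi
    congr 1
    simp only [blockOne, stack]
    rw [if_pos (by omega : i - 1 ≤ s)]
  · rw [Finset.sum_eq_single (n - 1)]
    · simp only [extMat, stack, hn, if_false, blockOne]
      rw [if_pos (by omega : n - 1 + 1 = n), if_neg (by omega : ¬ n - 1 = 0), one_mul]
      by_cases hm : m = 0
      · rw [if_pos hm, if_neg (by omega)]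
      · rw [if_neg hm]
        by_cases h1 : n - 1 - 1 ≤ s
        · have hn2 : n = s + 2 := by omega
          subst hn2
          simp only [h1, if_true]
          rw [if_pos (by omega)]
          congr 1 <;> omega
        · rw [if_neg h1]
          by_cases h2 : n ≤ 2 * (s + 1) ∧ n - (s + 1) ≤ m
          · rw [if_pos h2, if_pos (by omega)]
            congr 1 <;> omega
          · rw [if_neg h2, if_neg (by omega)]
    · intro i _ hi
      simp only [extMat, hn, if_false]
      rw [if_neg (by omega), zero_mul]
    · intro h
      simp only [Finset.mem_range] at h
      omega

lemma stack_zero_totallyPos {A : ℕ → ℕ → ℝ} (hAtri : ∀ n k, n < k → A n k = 0)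
    (h0 : 0 ≤ A 0 0) : TotallyPos (stack A 0) := by
  intro k f g hf hg
  match k with
  | 0 => simp
  | 1 =>
    simp only [Matrix.det_unique, Matrix.of_apply, stack]
    split_ifs with h1 h2
    · have : f default = 0 := by omega
      rw [this]
      rcases Nat.eq_zero_or_pos (g default) with h | h
      · rw [h]; exact h0
      · rw [hAtri _ _ h]
    · omega
    · rfl
  | k + 2 =>
    have : f 0 < f (Fin.last _) := hf (Fin.last_pos)
    rw [Matrix.det_eq_zero_of_row_eq_zero (Fin.last _)]
    intro j
    simp only [Matrix.of_apply, stack]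
    rw [if_neg (by omega), if_neg (by omega)]

lemma stack_totallyPos {A Q : ℕ → ℕ → ℝ}
    (hAtri : ∀ n k, n < k → A n k = 0)
    (hQtri : ∀ n k, n < k → Q n k = 0)
    (hprod : ∀ n k, A n k = ∑ i ∈ Finset.range (n + 1), Q n i * blockOne A i k)
    (hQ : TotallyPos Q) (s : ℕ) : TotallyPos (stack A s) := by
  induction s with
  | zero =>
    refine stack_zero_totallyPos hAtri ?_
    have h := hQ 1 (fun _ => 0) (fun _ => 0) (Subsingleton.strictMono _) (Subsingleton.strictMono _)
    rw [hprod]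
    simpa [blockOne] using h
  | succ s ih =>
    rw [stack_succ hprod]
    exact (extMat_totallyPos hQtri hQ (s + 1)).mul ih.blockOne (extMat_tri hQtri _)

/-- Let `A` be lower triangular with nonzero diagonal whose left production
matrix `Q` (defined by `A = Q ⬝ blockdiag(1, A)`) is totally positive. Then the
reversal `[a_{n,n-k}]` of `A` is totally positive. -/
theorem totallyPos_reversal_of_leftProduction (A Q : ℕ → ℕ → ℝ)
    (hAtri : ∀ n k, n < k → A n k = 0) (hdiag : ∀ n, A n n ≠ 0)
    (hQtri : ∀ n k, n < k → Q n k = 0)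
    (hprod : ∀ n k, A n k = ∑ i ∈ Finset.range (n + 1), Q n i * blockOne A i k)
    (hQ : TotallyPos Q) :
    TotallyPos (fun n k => if k ≤ n then A n (n - k) else 0) := by 
  intro k f g hf hg
  obtain ⟨N, hN⟩ : ∃ N, ∀ i, f i < N :=
    ⟨Finset.univ.sup f + 1, fun i => Nat.lt_succ_of_le (Finset.le_sup (Finset.mem_univ i))⟩
  obtain ⟨N', hN'⟩ : ∃ N, ∀ i, g i < N :=
    ⟨Finset.univ.sup g + 1, fun i => Nat.lt_succ_of_le (Finset.le_sup (Finset.mem_univ i))⟩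
  obtain ⟨s, hs⟩ : ∃ s, s = N + N' := ⟨_, rfl⟩
  have h := stack_totallyPos hAtri hQtri hprod hQ s k
    (fun i => 2 * s - f i.rev) (fun j => s - g j.rev)
    (fun a b hab => by
      have h1 := hf (Fin.rev_lt_rev.mpr hab)
      have h2 := hN a.rev
      show 2 * s - f a.rev < 2 * s - f b.rev
      omega)
    (fun a b hab => by
      have h1 := hg (Fin.rev_lt_rev.mpr hab)
      have h2 := hN' a.rev
      show s - g a.rev < s - g b.rev
      omega)
  rw [← Matrix.det_submatrix_equiv_self Fin.revPerm] at h
  convert h using 2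
  ext i j
  have h1 := hN i
  have h2 := hN' j
  simp only [Matrix.of_apply, Matrix.submatrix_apply, Fin.revPerm_apply, Fin.rev_rev, stack]
  rw [if_neg (by omega : ¬ 2 * s - f i ≤ s)]
  by_cases hle : g j ≤ f i
  · rw [if_pos hle, if_pos (by omega)]
    congr 1 <;> omega
  · rw [if_neg hle, if_neg (by omega)]
end

section
/- Let A = [a_{n,k}]_{n,k≥0} be an infinite lower triangular matrix with nonzero diagonals whose left production matrix Q(A) is totally positive. Then for each n ≥ 0 the row polynomial ∑_{k=0}^{n} a_{n,k} x^k is real-rooted (constant or all roots real). -/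
/-- Finite version of total nonnegativity. -/
def TNm {m N : ℕ} (C : Matrix (Fin m) (Fin N) ℝ) : Prop :=
  ∀ (k : ℕ) (f : Fin k → Fin m) (g : Fin k → Fin N), StrictMono f → StrictMono g →
    0 ≤ Matrix.det (C.submatrix f g)

theorem TNm.submatrix {m N m' N' : ℕ} {C : Matrix (Fin m) (Fin N) ℝ} (h : TNm C)
    {f : Fin m' → Fin m} {g : Fin N' → Fin N} (hf : StrictMono f) (hg : StrictMono g) :
    TNm (C.submatrix f g) := by
  intro k f' g' hf' hg'
  rw [Matrix.submatrix_submatrix]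
  exact h k _ _ (hf.comp hf') (hg.comp hg')

open Matrix in
/-- Carathéodory-style reduction: kill one coordinate along a kernel vector. -/
theorem reduce_col {m N : ℕ} (C : Matrix (Fin m) (Fin (N + 1)) ℝ) (v α : Fin (N + 1) → ℝ)
    (hα : α ≠ 0) (hC : C *ᵥ α = 0) :
    ∃ (b : Fin (N + 1)) (v' : Fin N → ℝ), (C.submatrix id b.succAbove) *ᵥ v' = C *ᵥ v ∧
      ∀ (j : Fin N) (c : ℝ), 0 < c * v' j → 0 < c * v (b.succAbove j) := by
  classical
  have hne : (Finset.univ.filter fun j => α j ≠ 0).Nonempty := by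
    obtain ⟨j, hj⟩ := Function.ne_iff.1 hα
    exact ⟨j, by simpa using hj⟩
  obtain ⟨b, hb, hmin⟩ := Finset.exists_min_image _ (fun j => |v j| / |α j|) hne
  have hb' : α b ≠ 0 := by simpa using hb
  set t : ℝ := -(v b / α b) with ht
  have hbz : v b + t * α b = 0 := by rw [ht]; field_simp; ring
  have hle : ∀ j, |t * α j| ≤ |v j| := by
    intro j
    by_cases hj : α j = 0
    · simp [hj]
    · have h1 := hmin j (by simpa using hj)
      rw [le_div_iff₀ (abs_pos.2 hj)] at h1
      rw [abs_mul, ht, abs_neg, abs_div]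
      exact h1
  refine ⟨b, fun j => v (b.succAbove j) + t * α (b.succAbove j), ?_, ?_⟩
  · have h2 : C *ᵥ (v + t • α) = C *ᵥ v := by
      rw [mulVec_add, mulVec_smul, hC]; simp
    rw [← h2]
    ext i
    simp only [mulVec, dotProduct, submatrix_apply, id, Pi.add_apply, Pi.smul_apply, smul_eq_mul]
    rw [Fin.sum_univ_succAbove _ b, hbz]
    simp
  · intro j c h
    have h3 := hle (b.succAbove j)
    simp only at h
    by_contra hcon
    push Not at hcon
    have h4 : |c * (t * α (b.succAbove j))| ≤ |c * v (b.succAbove j)| := by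
      rw [abs_mul, abs_mul c]; gcongr
    rw [abs_of_nonpos hcon] at h4
    have := le_abs_self (c * (t * α (b.succAbove j)))
    nlinarith

open Matrix in
/-- Strict variation diminishing. -/
theorem vd_strict (N : ℕ) : ∀ (m : ℕ) (C : Matrix (Fin m) (Fin N) ℝ) (_ : TNm C)
    (v : Fin N → ℝ) (ε : ℝ) (_ : ∀ i : Fin m, 0 < ε * (-1) ^ (i : ℕ) * (C *ᵥ v) i),
    ∃ f : Fin m → Fin N, StrictMono f ∧ ∀ j : Fin m, 0 < ε * (-1) ^ (j : ℕ) * v (f j) := by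
  induction N with
  | zero =>
    intro m C hC v ε h
    rcases m with _ | m
    · exact ⟨Fin.elim0, fun i => i.elim0, fun i => i.elim0⟩
    · have := h 0
      simp [mulVec, dotProduct] at this
  | succ N ih =>
    -- common reduction
    have red : ∀ (m : ℕ) (C : Matrix (Fin m) (Fin (N + 1)) ℝ) (_ : TNm C)
        (v α : Fin (N + 1) → ℝ) (ε : ℝ)
        (_ : ∀ i : Fin m, 0 < ε * (-1) ^ (i : ℕ) * (C *ᵥ v) i) (_ : α ≠ 0) (_ : C *ᵥ α = 0),
        m ≤ N ∧ 
        ∃ f : Fin m → Fin (N + 1), StrictMono f ∧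
          ∀ j : Fin m, 0 < ε * (-1) ^ (j : ℕ) * v (f j) := by
      intro m C hC v α ε h hα hCα
      obtain ⟨b, v', h1, h2⟩ := reduce_col C v α hα hCα
      obtain ⟨f, hf, hf'⟩ := ih m (C.submatrix id b.succAbove)
        (hC.submatrix strictMono_id (Fin.strictMono_succAbove b)) v' ε (by rw [h1]; exact h)
      refine ⟨by simpa using Fintype.card_le_of_injective f hf.injective,
        fun j => b.succAbove (f j), (Fin.strictMono_succAbove b).comp hf, 
        fun j => h2 _ _ (hf' j)⟩
    intro m C hC v ε h
    by_cases hker : ∃ α : Fin (N + 1) → ℝ, α ≠ 0 ∧ C *ᵥ α = 0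
    · obtain ⟨α, hα, hCα⟩ := hker
      exact (red m C hC v α ε h hα hCα).2
    have hm : N + 1 ≤ m := by
      by_contra hlt
      apply hker
      have := Matrix.mulVecLin C
      obtain ⟨α, hα, hne⟩ := Submodule.exists_mem_ne_zero_of_ne_bot
        (LinearMap.ker_ne_bot_of_finrank_lt (f := C.mulVecLin) (by simpa using hlt))
      exact ⟨α, hne, by simpa using hα⟩
    rcases hm.eq_or_lt with rfl | hlt
    · have hdet : C.det ≠ 0 := fun h0 => hker (by
        obtain ⟨α, h1, h2⟩ := Matrix.exists_mulVec_eq_zero_iff.2 h0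
        exact ⟨α, h1, h2⟩)
      have hpos : 0 < C.det := by
        have := hC (N + 1) id id strictMono_id strictMono_id
        rw [submatrix_id_id] at this
        exact lt_of_le_of_ne this (Ne.symm hdet)
      refine ⟨id, strictMono_id, fun j => ?_⟩
      have hM : ∀ i, 0 ≤ (C.submatrix (Fin.succAbove i) j.succAbove).det := fun i =>
        hC N _ _ (Fin.strictMono_succAbove i) (Fin.strictMono_succAbove j)
      have hcr : C.det * v j = ∑ i : Fin (N + 1), (-1) ^ (i + j : ℕ) * (C *ᵥ v) i *
          (C.submatrix (Fin.succAbove i) j.succAbove).det := by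
        have h1 : cramer C (C *ᵥ v) j = C.det * v j := by
          rw [cramer_eq_adjugate_mulVec, mulVec_mulVec, adjugate_mul, smul_mulVec, one_mulVec]
          simp
        rw [← h1, cramer_apply, det_succ_column _ j]
        refine Finset.sum_congr rfl fun i _ => ?_
        simp
      have hs : ε * (-1) ^ (j : ℕ) * (C.det * v j) = ∑ i : Fin (N + 1),
          (ε * (-1) ^ (i : ℕ) * (C *ᵥ v) i) *
          (C.submatrix (Fin.succAbove i) j.succAbove).det := by
        rw [hcr, Finset.mul_sum]
        refine Finset.sum_congr rfl fun i _ => ?_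
        have : ((-1 : ℝ)) ^ (j : ℕ) * (-1) ^ (j : ℕ) = 1 := by
          rw [← mul_pow]; simp
        rw [pow_add]
        linear_combination (ε * (-1) ^ (i : ℕ) * (C *ᵥ v) i *
          (C.submatrix (Fin.succAbove i) j.succAbove).det) * this
      have hex : ∃ i, (C.submatrix (Fin.succAbove i) j.succAbove).det ≠ 0 := by
        by_contra hall
        push Not at hall
        apply hdet
        rw [det_succ_column C j]
        exact Finset.sum_eq_zero fun i _ => by rw [hall i, mul_zero]
      obtain ⟨i, hi⟩ := hex
      have hsp : 0 < ε * (-1) ^ (j : ℕ) * (C.det * v j) := by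
        rw [hs]
        exact Finset.sum_pos' (fun i _ => mul_nonneg (h i).le (hM i))
          ⟨i, Finset.mem_univ _, mul_pos (h i) (lt_of_le_of_ne (hM i) (Ne.symm hi))⟩
      have : 0 < C.det * (ε * (-1) ^ (j : ℕ) * v j) := by
        calc _ < _ := hsp
          _ = _ := by ring
      exact (mul_pos_iff_of_pos_left hpos).1 this
    · exfalso
      set r : Fin (N + 2) → Fin m := Fin.castLE hlt with hr
      have hrm : StrictMono r := Fin.strictMono_castLE hlt
      set C' := C.submatrix r id with hC'
      have hC'T : TNm C' := hC.submatrix hrm strictMono_id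
      have hu : ∀ i : Fin (N + 2), 0 < ε * (-1) ^ (i : ℕ) * (C' *ᵥ v) i := fun i => h (r i)
      set D : Matrix (Fin (N + 2)) (Fin (N + 2)) ℝ :=
        Matrix.of fun i => (Fin.cons ((C' *ᵥ v) i) (C' i) : Fin (N + 2) → ℝ) with hD
      have hD0 : D.det = 0 := by
        rw [← Matrix.exists_mulVec_eq_zero_iff]
        refine ⟨Fin.cons (-1) v, fun h0 => ?_, ?_⟩
        · have := congrFun h0 0
          simp at this
        · ext i
          simp [hD, mulVec, dotProduct, Fin.sum_univ_succ]
      rw [det_succ_column_zero] at hD0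
      have hM : ∀ i : Fin (N + 2), 0 ≤ (C'.submatrix i.succAbove id).det := fun i =>
        hC'T _ _ _ (Fin.strictMono_succAbove i) strictMono_id
      have hsum : ∑ i : Fin (N + 2), (ε * (-1) ^ (i : ℕ) * (C' *ᵥ v) i) *
          (C'.submatrix i.succAbove id).det = 0 := by
        rw [← mul_zero ε, ← hD0, Finset.mul_sum]
        refine Finset.sum_congr rfl fun i _ => ?_
        have : D.submatrix i.succAbove Fin.succ = C'.submatrix i.succAbove id := by
          ext a b; simp [hD]
        rw [this]
        simp only [hD, of_apply, Fin.cons_zero]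
        ring
      rw [Finset.sum_eq_zero_iff_of_nonneg
        (fun i _ => mul_nonneg (hu i).le (hM i))] at hsum
      have hlast := hsum (Fin.last _) (Finset.mem_univ _)
      have hdl : (C'.submatrix (Fin.last (N + 1)).succAbove id).det = 0 :=
        (mul_eq_zero.1 hlast).resolve_left (hu _).ne'
      obtain ⟨α, hα, hCα⟩ := Matrix.exists_mulVec_eq_zero_iff.2 hdl
      have := (red (N + 1) (C'.submatrix (Fin.last (N + 1)).succAbove id)
        (hC'T.submatrix (Fin.strictMono_succAbove _) strictMono_id) v α ε (fun i => by
          have := hu (Fin.castSucc i)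
          simpa [mulVec, dotProduct] using this) hα hCα).1
      omega

/-- Weak alternation of length `p`. -/
def AltW {N : ℕ} (p : ℕ) (v : Fin N → ℝ) : Prop :=
  ∃ f : Fin p → Fin N, StrictMono f ∧ ∃ ε : ℝ, (ε = 1 ∨ ε = -1) ∧
    ∀ j : Fin p, 0 ≤ ε * (-1) ^ (j : ℕ) * v (f j)

theorem isClosed_altW {N : ℕ} (p : ℕ) : IsClosed {v : Fin N → ℝ | AltW p v} := by
  have : {v : Fin N → ℝ | AltW p v} = ⋃ f : {f : Fin p → Fin N // StrictMono f},
      ({v | ∀ j : Fin p, 0 ≤ (1 : ℝ) * (-1) ^ (j : ℕ) * v (f.1 j)} ∪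
        {v | ∀ j : Fin p, 0 ≤ (-1 : ℝ) * (-1) ^ (j : ℕ) * v (f.1 j)}) := by
    ext v
    simp only [AltW, Set.mem_ofPred_eq, Set.mem_iUnion, Set.mem_union]
    constructor
    · rintro ⟨f, hf, ε, rfl | rfl, h⟩
      · exact ⟨⟨f, hf⟩, Or.inl h⟩
      · exact ⟨⟨f, hf⟩, Or.inr h⟩
    · rintro ⟨f, h | h⟩
      · exact ⟨f.1, f.2, 1, Or.inl rfl, h⟩
      · exact ⟨f.1, f.2, -1, Or.inr rfl, h⟩
  rw [this]
  refine isClosed_iUnion_of_finite fun f => IsClosed.union ?_ ?_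
  all_goals
    simp only [Set.ofPred_forall]
    exact isClosed_iInter fun j => isClosed_le continuous_const (by fun_prop)

open Matrix Filter Topology in
/-- Weak variation diminishing for nonsingular totally nonnegative matrices. -/
theorem vd_weak {N p : ℕ} (C : Matrix (Fin N) (Fin N) ℝ) (hC : TNm C) (hdet : C.det ≠ 0)
    (v : Fin N → ℝ) (h : AltW p (C *ᵥ v)) : AltW p v := by
  obtain ⟨f, hf, ε, hε, hj⟩ := h
  have hε2 : ε * ε = 1 := by rcases hε with rfl | rfl <;> norm_num
  set e : Fin N → ℝ := fun i => ∑ j : Fin p, if f j = i then ε * (-1) ^ (j : ℕ) else 0 with he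
  have hef : ∀ j, e (f j) = ε * (-1) ^ (j : ℕ) := by
    intro j
    simp [he, hf.injective.eq_iff]
  have hinv : C *ᵥ (C⁻¹ *ᵥ e) = e := by
    rw [mulVec_mulVec, mul_nonsing_inv _ (isUnit_iff_ne_zero.2 hdet), one_mulVec]
  have key : ∀ t : ℝ, 0 < t → AltW p (v + t • (C⁻¹ *ᵥ e)) := by
    intro t ht
    obtain ⟨g, hg, hg'⟩ := vd_strict N p (C.submatrix f id) (hC.submatrix hf strictMono_id)
      (v + t • (C⁻¹ *ᵥ e)) ε (by
        intro i
        have h1 : (C.submatrix f id *ᵥ (v + t • (C⁻¹ *ᵥ e))) i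
            = (C *ᵥ v) (f i) + t * (ε * (-1) ^ (i : ℕ)) := by
          have : (C.submatrix f id *ᵥ (v + t • (C⁻¹ *ᵥ e))) i
            = (C *ᵥ (v + t • (C⁻¹ *ᵥ e))) (f i) := rfl
          rw [this, mulVec_add, mulVec_smul, hinv]
          simp [hef]
        rw [h1]
        have h2 := hj i
        have h3 : ((-1 : ℝ)) ^ (i : ℕ) * (-1) ^ (i : ℕ) = 1 := by
          rw [← mul_pow]; simp
        have h4 : ε * (-1) ^ (i : ℕ) * ((C *ᵥ v) (f i) + t * (ε * (-1) ^ (i : ℕ)))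
          = ε * (-1) ^ (i : ℕ) * (C *ᵥ v) (f i) + t := by
          linear_combination t * ((-1) ^ (i : ℕ) * (-1) ^ (i : ℕ)) * hε2 + t * h3
        rw [h4]; linarith)
    exact ⟨g, hg, ε, hε, fun j => (hg' j).le⟩
  have hlim : Tendsto (fun t : ℝ => v + t • (C⁻¹ *ᵥ e)) (𝓝[>] 0) (𝓝 v) := by
    have : Tendsto (fun t : ℝ => v + t • (C⁻¹ *ᵥ e)) (𝓝 0) (𝓝 (v + (0 : ℝ) • (C⁻¹ *ᵥ e))) :=
      Continuous.tendsto (by fun_prop) _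
    rw [zero_smul, add_zero] at this
    exact this.mono_left nhdsWithin_le_nhds
  exact (isClosed_altW p).mem_of_tendsto hlim
    (eventually_nhdsWithin_of_forall fun t ht => key t ht)

theorem shift_base {n p : ℕ} (r w : Fin (n + 1) → ℝ)
    (hw : ∀ i : Fin n, w i.castSucc = r i.succ) (hl : w (Fin.last n) = 0)
    (f : Fin p → Fin (n + 1)) (hf : StrictMono f) (hf0 : ∀ j, f j ≠ 0)
    (ε : ℝ) (hε : ε = 1 ∨ ε = -1)
    (h : ∀ j : Fin p, 0 ≤ ε * (-1) ^ (j : ℕ) * r (f j)) : AltW (p + 1) w := by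
  refine ⟨Fin.snoc (α := fun _ => Fin (n + 1)) (fun j => ((f j).pred (hf0 j)).castSucc)
    (Fin.last n), ?_, ε, hε, ?_⟩
  · intro a b hab
    induction b using Fin.lastCases with
    | last =>
      induction a using Fin.lastCases with
      | last => exact absurd hab (lt_irrefl _)
      | cast a => simp [Fin.castSucc_lt_last]
    | cast b =>
      induction a using Fin.lastCases with
      | last => exact absurd hab (not_lt.2 (Fin.le_last _))
      | cast a =>
        have hab' : a < b := by simpa using hab
        simpa using hf hab'
  · intro j
    induction j using Fin.lastCases with
    | last => simp [hl]
    | cast j => simpa [hw] using h j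

theorem shift_weak {n p : ℕ} (r w : Fin (n + 1) → ℝ)
    (hw : ∀ i : Fin n, w i.castSucc = r i.succ) (hl : w (Fin.last n) = 0)
    (h : AltW p r) : AltW p w := by
  obtain ⟨f, hf, ε, hε, h⟩ := h
  rcases p with _ | p
  · exact ⟨Fin.elim0, fun i => i.elim0, 1, Or.inl rfl, fun i => i.elim0⟩
  · refine shift_base r w hw hl (fun j => f j.succ) (hf.comp Fin.strictMono_succ) ?_ (-ε) ?_ ?_
    · intro j h0
      have := hf (Fin.succ_pos j)
      rw [h0] at this
      exact absurd this (Fin.not_lt_zero _)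
    · rcases hε with rfl | rfl <;> simp
    · intro j
      have := h j.succ
      rw [Fin.val_succ, pow_succ] at this
      linarith

theorem shift_strict {n p : ℕ} (r w : Fin (n + 2) → ℝ)
    (hw : ∀ i : Fin (n + 1), w i.castSucc = r i.succ) (hl : w (Fin.last (n + 1)) = 0)
    (h01 : 0 < r 0 * r 1) (h : AltW p r) : AltW (p + 1) w := by
  obtain ⟨f, hf, ε, hε, h⟩ := h
  have hε2 : ε * ε = 1 := by rcases hε with rfl | rfl <;> norm_num
  rcases p with _ | p
  · exact shift_base r w hw hl f hf (fun j => j.elim0) ε hε h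
  by_cases h0 : f 0 = 0
  · have hr0 : 0 ≤ ε * r 0 := by simpa [h0] using h 0
    have hr1 : 0 < ε * r 1 := by
      have h1 : 0 < (ε * r 0) * (ε * r 1) := by
        have : (ε * r 0) * (ε * r 1) = r 0 * r 1 := by linear_combination (r 0 * r 1) * hε2
        rw [this]; exact h01
      by_contra hc
      push Not at hc
      nlinarith [mul_nonneg hr0 (neg_nonneg.2 hc)]
    have hgt : ∀ j : Fin p, 1 < f j.succ := by
      intro j
      have h2 : f 0 < f j.succ := hf (Fin.succ_pos j)
      rw [h0] at h2
      rcases (Fin.one_le_of_ne_zero h2.ne').eq_or_lt with h3 | h3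
      · exfalso
        have hj0 : (j : ℕ) = 0 := by
          by_contra hj
          have hp : 0 < p := j.pos
          have h4 : f (Fin.succ ⟨0, hp⟩) < f j.succ := hf (by
            rw [Fin.succ_lt_succ_iff, Fin.lt_def]; simp; omega)
          have h5 : f 0 < f (Fin.succ ⟨0, hp⟩) := hf (Fin.succ_pos _)
          rw [h0] at h5
          rw [← h3] at h4
          rw [Fin.lt_def] at h4 h5
          simp at h4 h5
          rw [h4] at h5
          simp at h5
        have := h j.succ
        rw [← h3, Fin.val_succ, hj0] at this
        simp at this
        linarith
      · exact h3
    refine shift_base r w hw hl (Fin.cons 1 fun j => f j.succ) ?_ ?_ ε hε ?_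
    · intro a b hab
      induction b using Fin.cases with
      | zero => exact absurd hab (Fin.not_lt_zero _)
      | succ b =>
        induction a using Fin.cases with
        | zero => simpa using hgt b
        | succ a => simpa using hf hab
    · intro j
      induction j using Fin.cases with
      | zero => simp
      | succ j =>
        have := hgt j
        intro hc
        simp at hc
        rw [hc] at this
        exact absurd this (Fin.not_lt_zero _)
    · intro j
      induction j using Fin.cases with
      | zero => simpa using hr1.le
      | succ j => simpa using h j.succ
  · refine shift_base r w hw hl f hf ?_ ε hε h
    intro j hj
    have := hf.monotone (Fin.zero_le j)
    rw [hj] at this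
    exact h0 (le_antisymm this (Fin.zero_le _))

theorem AltW.smul {N p : ℕ} {v w : Fin N → ℝ} (h : AltW p v) {c : ℝ} (hc : 0 ≤ c)
    (hw : ∀ i, w i = c * v i) : AltW p w := by
  obtain ⟨f, hf, ε, hε, h⟩ := h
  refine ⟨f, hf, ε, hε, fun j => ?_⟩
  rw [hw]
  have := mul_nonneg hc (h j)
  linarith

open Matrix Filter Topology in
/-- The core spectral argument. -/
theorem core {n : ℕ} (C : Matrix (Fin (n + 2)) (Fin (n + 2)) ℝ) (hC : TNm C)
    (hdet : C.det ≠ 0) (z : ℂ) (hz : z.im ≠ 0) (v : Fin (n + 2) → ℂ) (hv0 : v 0 = 1)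
    (hv1 : (v 1).im ≠ 0)
    (hv : ∀ i : Fin (n + 1), z * ∑ j, (C i.castSucc j : ℂ) * v j = v i.succ)
    (hvl : z * ∑ j, (C (Fin.last _) j : ℂ) * v j = 0) : False := by
  set r : ℂ → Fin (n + 2) → ℝ := fun ω i => (ω * v i).re with hr
  have hCr : ∀ ω i, (C *ᵥ r (ω * z)) i = (ω * (z * ∑ j, (C i j : ℂ) * v j)).re := by
    intro ω i
    simp only [mulVec, dotProduct, hr, Finset.mul_sum, Complex.re_sum]
    refine Finset.sum_congr rfl fun j _ => ?_
    rw [← Complex.re_ofReal_mul]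
    congr 1
    ring
  have hw : ∀ ω, ∀ i : Fin (n + 1), (C *ᵥ r (ω * z)) i.castSucc = r ω i.succ := by
    intro ω i
    rw [hCr, hv]
  have hl : ∀ ω, (C *ᵥ r (ω * z)) (Fin.last _) = 0 := by
    intro ω
    rw [hCr, hvl]; simp
  have step : ∀ ω p, AltW p (r ω) → AltW p (r (ω * z)) := fun ω p h =>
    vd_weak C hC hdet _ (shift_weak (r ω) _ (hw ω) (hl ω) h)
  obtain ⟨ω, hω⟩ : ∃ ω, 0 < r ω 0 * r ω 1 := by
    refine ⟨⟨1, ((v 1).re - 1) / (v 1).im⟩, ?_⟩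
    have : r ⟨1, ((v 1).re - 1) / (v 1).im⟩ 1 = 1 := by
      simp only [hr, Complex.mul_re]
      field_simp
      ring
    rw [this]
    simp [hr, hv0]
  have sstep : ∀ p, AltW p (r ω) → ∀ k : ℕ, AltW (p + 1) (r (ω * z ^ (k + 1))) := by
    intro p h k
    induction k with
    | zero =>
      simpa using vd_weak C hC hdet _ (shift_strict (r ω) _ (hw ω) (hl ω) hω h)
    | succ k ih =>
      have := step _ _ ih
      rwa [mul_assoc, ← pow_succ] at this
  have hz0 : z ≠ 0 := fun h => hz (by simp [h])
  have hnz : 0 < ‖z‖ := norm_pos_iff.2 hz0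
  obtain ⟨ζ, hζ⟩ : ∃ ζ : Circle, (ζ : ℂ) = z / ‖z‖ := by
    have h1 : ‖z / (‖z‖ : ℂ)‖ = 1 := by
      rw [norm_div]; simp [hnz.ne']
    exact ⟨⟨z / ‖z‖, mem_sphere_zero_iff_norm.2 h1⟩, rfl⟩
  have hcl : ∀ p, AltW p (r ω) → AltW (p + 1) (r ω) := by
    intro p h
    have hcont : Continuous fun c : Circle => r (ω * c) := by
      simp only [hr]
      fun_prop
    have hS : IsClosed {c : Circle | AltW (p + 1) (r (ω * c))} :=
      (isClosed_altW (p + 1)).preimage hcont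
    have hmem : (1 : Circle) ∈ {c : Circle | AltW (p + 1) (r (ω * c))} := by
      have hm := mapClusterPt_one_atTop_pow ζ
      by_contra hne
      have hev := hm.frequently (hS.isOpen_compl.mem_nhds hne)
      obtain ⟨k, hk, hk'⟩ := (hev.and_eventually (eventually_ge_atTop 1)).exists
      obtain ⟨k, rfl⟩ := Nat.exists_eq_add_of_le' hk'
      apply hk
      refine (sstep p h k).smul (c := ((‖z‖) ^ (k + 1))⁻¹) (by positivity) fun i => ?_
      simp only [hr]
      rw [← Complex.re_ofReal_mul]
      congr 1
      rw [Circle.coe_pow, hζ]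
      push_cast
      rw [div_pow]
      field_simp
    simpa using hmem
  have hall : ∀ p, AltW p (r ω) := by
    intro p
    induction p with
    | zero => exact ⟨Fin.elim0, fun i => i.elim0, 1, Or.inl rfl, fun i => i.elim0⟩
    | succ p ih => exact hcl p ih
  obtain ⟨f, hf, -⟩ := hall (n + 3)
  have := Fintype.card_le_of_injective f hf.injective
  simp at this

/-- Let `A` be lower triangular with nonzero diagonal whose left production
matrix `Q` (defined by `A = Q ⬝ blockdiag(1, A)`) is totally positive. Then each
row polynomial `∑_{k=0}^n a_{n,k} x^k` is real-rooted. -/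
theorem realRooted_rows_of_leftProduction (A Q : ℕ → ℕ → ℝ)
    (hAtri : ∀ n k, n < k → A n k = 0) (hdiag : ∀ n, A n n ≠ 0)
    (hQtri : ∀ n k, n < k → Q n k = 0)
    (hprod : ∀ n k, A n k = ∑ i ∈ Finset.range (n + 1), Q n i * blockOne A i k)
    (hQ : TotallyPos Q) :
    ∀ n : ℕ,
      RealRooted (∑ k ∈ Finset.range (n + 1), Polynomial.C (A n k) * Polynomial.X ^ k) := by
  intro n
  rcases n with _ | n
  · left
    simp
  right
  intro z hroot
  by_contra hz
  set a : ℕ → ℂ := fun m => ∑ k ∈ Finset.range (m + 1), (A m k : ℂ) * z ^ k with ha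
  have haN : ∀ m M, m + 1 ≤ M → ∑ k ∈ Finset.range M, (A m k : ℂ) * z ^ k = a m := by
    intro m M hM
    symm
    refine Finset.sum_subset (by simpa using hM) fun k _ hk => ?_
    rw [hAtri m k (by simpa using hk)]
    simp
  have hroot' : a (n + 1) = 0 := by
    rw [← hroot]
    simp [ha, map_sum]
  set v : ℕ → ℂ := fun i => if i = 0 then 1 else z * a (i - 1) with hv
  have hblock : ∀ i m, i ≤ m →
      ∑ k ∈ Finset.range (m + 1), (blockOne A i k : ℂ) * z ^ k = v i := by
    intro i m him
    rw [Finset.sum_range_succ']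
    rcases i with _ | i
    · simp [blockOne, hv]
    · simp only [blockOne, hv]
      simp only [Nat.add_one_ne_zero, if_false, if_true, Nat.add_sub_cancel]
      rw [← haN i m him, Finset.mul_sum]
      simp only [Complex.ofReal_zero, zero_mul, add_zero]
      exact Finset.sum_congr rfl fun k _ => by ring
  have hrec : ∀ m, a m = ∑ i ∈ Finset.range (m + 1), (Q m i : ℂ) * v i := by
    intro m
    simp only [ha]
    rw [Finset.sum_congr rfl fun k _ => by rw [hprod m k]]
    push_cast
    simp only [Finset.sum_mul]
    rw [Finset.sum_comm]
    refine Finset.sum_congr rfl fun i hi => ?_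
    rw [← hblock i m (by simpa [Nat.lt_succ_iff] using hi), Finset.mul_sum]
    exact Finset.sum_congr rfl fun k _ => by ring
  have hQd : ∀ m, Q m m ≠ 0 := by
    intro m h0
    apply hdiag m
    rw [hprod m m, Finset.sum_range_succ, h0, zero_mul, add_zero]
    refine Finset.sum_eq_zero fun i hi => ?_
    have hi' : i < m := by simpa using hi
    have : blockOne A i m = 0 := by
      unfold blockOne
      split_ifs with h1 h2 h2
      · omega
      · rfl
      · rfl
      · exact hAtri _ _ (by omega)
    rw [this, mul_zero]
  set C : Matrix (Fin (n + 2)) (Fin (n + 2)) ℝ := Matrix.of fun i j => Q i j with hCdef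
  have hCT : TNm C := by
    intro k f g hf hg
    exact hQ k (fun i => f i) (fun i => g i) hf hg
  have hdet : C.det ≠ 0 := by
    rw [Matrix.det_of_lowerTriangular C (fun i j hij => hQtri _ _ hij)]
    exact Finset.prod_ne_zero_iff.2 fun i _ => hQd _
  have hsum : ∀ i : Fin (n + 2), ∑ j, (C i j : ℂ) * v (j : ℕ) = a i := by
    intro i
    rw [hrec]
    refine (Fin.sum_univ_eq_sum_range (fun j => (Q i j : ℂ) * v j) (n + 2)).trans ?_
    symm
    refine Finset.sum_subset (Finset.range_subset_range.2 i.is_lt) fun k _ hk => ?_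
    rw [hQtri _ k (by simpa using hk)]
    simp
  refine core C hCT hdet z hz (fun i => v i) (by simp [hv]) ?_ ?_ ?_
  · simp only [hv, ha]
    simp [hz, hdiag 0]
  · intro i
    rw [hsum]
    simp [hv]
  · rw [hsum]
    simp [hroot']
end
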